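/- Let t ≥ 2 be an even integer and let G be a 3-connected 2t-regular finite simple graph. Let 𝒪 be a set of pairwise edge-disjoint cycles of G, each of length at least 3. Then there exists a t-factor F of G such that, for every O ∈ 𝒪, both E(O) ∩ E(F) ≠ ∅ and E(O) ∩ (E(G) \ E(F)) ≠ ∅. -/

import Mathlib

open SimpleGraph

namespace PaperFormalization

variable {V : Type*}

/-- The degree of a vertex in a subgraph. -/
noncomputable def sdeg {G : SimpleGraph V} (H : G.Subgraph) (v : V) : ℕ :=
  (H.neighborSet v).ncard

/-- `H` is a `t`-factor of `G`: a spanning subgraph in which every vertex has degree `t`. -/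
def IsTFactor {G : SimpleGraph V} (H : G.Subgraph) (t : ℕ) : Prop :=
  H.IsSpanning ∧ ∀ v : V, sdeg H v = t

/-- A cycle of `G`: a connected 2-regular subgraph. -/
def IsCycleSG {G : SimpleGraph V} (C : G.Subgraph) : Prop :=
  C.Connected ∧ ∀ v ∈ C.verts, sdeg C v = 2

/-- An odd cycle: a cycle with an odd number of edges. -/
def IsOddCycleSG {G : SimpleGraph V} (C : G.Subgraph) : Prop :=
  IsCycleSG C ∧ Odd C.edgeSet.ncard

/-- A family of subgraphs is pairwise edge-disjoint. -/
def PairwiseEdgeDisjoint {G : SimpleGraph V} (𝒪 : Set G.Subgraph) : Prop :=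
  𝒪.Pairwise fun O₁ O₂ => Disjoint O₁.edgeSet O₂.edgeSet

/-- A family of subgraphs is pairwise vertex-disjoint. -/
def PairwiseVertexDisjoint {G : SimpleGraph V} (𝒪 : Set G.Subgraph) : Prop :=
  𝒪.Pairwise fun O₁ O₂ => Disjoint O₁.verts O₂.verts

/-- `G` is `r`-regular. -/
def IsRegular (G : SimpleGraph V) (r : ℕ) : Prop :=
  ∀ v : V, (G.neighborSet v).ncard = r

/-- `G` is 2-connected: connected, at least 3 vertices, and no cut vertex. -/
def TwoConnected [Fintype V] (G : SimpleGraph V) : Prop :=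
  G.Connected ∧ 3 ≤ Fintype.card V ∧ ∀ v : V, (G.induce {u | u ≠ v}).Connected

/-- `G` is `r`-connected: more than `r` vertices and deleting fewer than `r`
vertices leaves it connected. -/
def KConnected [Fintype V] (r : ℕ) (G : SimpleGraph V) : Prop :=
  r < Fintype.card V ∧ ∀ S : Set V, S.ncard < r → (G.induce Sᶜ).Connected

/-- A set of edges is a matching: pairwise non-adjacent edges. -/
def IsMatchingSet (M : Set (Sym2 V)) : Prop :=
  M.Pairwise fun e f => ∀ v : V, v ∈ e → v ∉ f


/-- The auxiliary graph of an incidence relation: incidences at a common point form a clique,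
and every block `O` carries a clique of size two less than the size of `O`, completely joined to
the incidences of `O`. -/
def gadget {V Ω : Type*} (inc : V → Ω → Prop) (N : Ω → ℕ) :
    SimpleGraph ({p : V × Ω // inc p.1 p.2} ⊕ (Σ O : Ω, Fin (N O))) where
  Adj
    | .inl x, .inl y => x ≠ y ∧ x.1.1 = y.1.1
    | .inl x, .inr i => x.1.2 = i.1
    | .inr i, .inl x => x.1.2 = i.1
    | .inr i, .inr j => i ≠ j ∧ i.1 = j.1
  symm := ⟨by
    rintro (x | i) (y | j) h
    · exact ⟨h.1.symm, h.2.symm⟩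
    · exact h
    · exact h
    · exact ⟨h.1.symm, h.2.symm⟩⟩
  loopless := ⟨by
    rintro (x | i) h
    · exact h.1 rfl
    · exact h.1 rfl⟩


section Components

variable {W : Type*} {Γ : SimpleGraph W} {S : Set W}

/-- The vertex `w` lies outside `S`, in the component `K` of `Γ - S`. -/
def InComp (K : ((⊤ : Γ.Subgraph).deleteVerts S).coe.ConnectedComponent) (w : W) : Prop :=
  ∃ h : w ∈ ((⊤ : Γ.Subgraph).deleteVerts S).verts, SimpleGraph.connectedComponentMk _ ⟨w, h⟩ = K

variable {K K' : ((⊤ : Γ.Subgraph).deleteVerts S).coe.ConnectedComponent} {a b : W}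

lemma InComp.notMem (h : InComp K a) : a ∉ S := h.1.2

lemma InComp.unique (h : InComp K a) (h' : InComp K' a) : K = K' := by
  obtain ⟨_, rfl⟩ := h
  exact h'.2

lemma InComp.of_adj (h : InComp K a) (hb : b ∉ S) (hab : Γ.Adj a b) : InComp K b := by
  obtain ⟨ha, rfl⟩ := h
  refine ⟨⟨trivial, hb⟩, ?_⟩
  rw [ConnectedComponent.eq]
  apply Adj.reachable
  rw [Subgraph.coe_adj, Subgraph.deleteVerts_adj]
  exact ⟨trivial, hb, trivial, ha.2, hab.symm⟩

lemma exists_inComp (K : ((⊤ : Γ.Subgraph).deleteVerts S).coe.ConnectedComponent) :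
    ∃ w, InComp K w := by
  induction K using ConnectedComponent.ind with
  | h v => exact ⟨v.1, v.2, rfl⟩

lemma InComp.induction {P : W → Prop} (ha : InComp K a) (hPa : P a)
    (hP : ∀ x y, InComp K x → InComp K y → Γ.Adj x y → P x → P y) (hb : InComp K b) : P b := by
  obtain ⟨hb, hb'⟩ := hb
  obtain ⟨ha', rfl⟩ := ha
  rw [eq_comm, ConnectedComponent.eq, reachable_iff_reflTransGen] at hb'
  suffices h : ∀ y, Relation.ReflTransGen ((⊤ : Γ.Subgraph).deleteVerts S).coe.Adj ⟨a, ha'⟩ y →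
      P y.1 ∧ InComp (SimpleGraph.connectedComponentMk _ ⟨a, ha'⟩) y.1 from (h _ hb').1
  intro y hy
  induction hy with
  | refl => exact ⟨hPa, ha', rfl⟩
  | @tail y z _ hyz ih =>
    have hyz' : Γ.Adj y.1 z.1 := by
      rw [Subgraph.coe_adj, Subgraph.deleteVerts_adj] at hyz
      exact hyz.2.2.2.2
    have hz := ih.2.of_adj z.2.2 hyz'
    exact ⟨hP _ _ ih.2 hz hyz' ih.1, hz⟩

lemma ncard_supp_eq_ncard_inComp
    (K : ((⊤ : Γ.Subgraph).deleteVerts S).coe.ConnectedComponent) :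
    K.supp.ncard = {w | InComp K w}.ncard := by
  rw [← Set.ncard_image_of_injective K.supp Subtype.val_injective]
  congr 1
  ext w
  simp [InComp, ConnectedComponent.mem_supp_iff]

end Components

lemma even_card_of_involution {α : Type*} (s : Finset α) (g : α → α)
    (hmem : ∀ a ∈ s, g a ∈ s) (hne : ∀ a ∈ s, g a ≠ a) (hinv : ∀ a ∈ s, g (g a) = a) :
    Even s.card := by
  have h : ∑ _x ∈ s, (1 : ZMod 2) = 0 :=
    Finset.sum_involution (fun a _ => g a) (fun _ _ => by decide) (fun a ha _ => hne a ha)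
      hmem hinv
  rw [Finset.sum_const, nsmul_one] at h
  exact (ZMod.natCast_eq_zero_iff_even).1 h

section Gadget

variable {V Ω : Type*} [Fintype V] [Fintype Ω] {inc : V → Ω → Prop} {N : Ω → ℕ}

open Finset in
open scoped Classical in
lemma gadget_not_isTutteViolator
    (hN : ∀ O, #{v | inc v O} = N O + 2) (hN1 : ∀ O, 1 ≤ N O)
    (hv : ∀ v, Even #{O | inc v O})
    (hb : ∀ K : Set Ω, K.Nonempty → Kᶜ.Nonempty →
      3 ≤ #{v | (∃ O ∈ K, inc v O) ∧ ∃ O ∉ K, inc v O})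
    (hcard : Even (Nat.card ({p : V × Ω // inc p.1 p.2} ⊕ (Σ O : Ω, Fin (N O)))))
    (S : Set ({p : V × Ω // inc p.1 p.2} ⊕ (Σ O : Ω, Fin (N O)))) :
    ¬ (gadget inc N).IsTutteViolator S := by
  let X := {p : V × Ω // inc p.1 p.2}
  intro hviol
  unfold IsTutteViolator at hviol
  set Γ := gadget inc N with hΓ
  -- cliques
  have hQ : ∀ {K : ((⊤ : Γ.Subgraph).deleteVerts S).coe.ConnectedComponent} {x y : X},
      InComp K (.inl x) → x.1.1 = y.1.1 → .inl y ∉ S → InComp K (.inl y) := by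
    intro K x y hx hxy hy
    by_cases h : x = y
    · exact h ▸ hx
    · exact hx.of_adj hy ⟨h, hxy⟩
  have hI : ∀ {K : ((⊤ : Γ.Subgraph).deleteVerts S).coe.ConnectedComponent}
      {i j : Σ O : Ω, Fin (N O)},
      InComp K (.inr i) → i.1 = j.1 → .inr j ∉ S → InComp K (.inr j) := by
    intro K x y hx hxy hy
    by_cases h : x = y
    · exact h ▸ hx
    · exact hx.of_adj hy ⟨h, hxy⟩
  have hXI : ∀ {K : ((⊤ : Γ.Subgraph).deleteVerts S).coe.ConnectedComponent}
      {x : X} {j : Σ O : Ω, Fin (N O)},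
      InComp K (.inl x) → x.1.2 = j.1 → .inr j ∉ S → InComp K (.inr j) :=
    fun hx hxy hy => hx.of_adj hy hxy
  have hIX : ∀ {K : ((⊤ : Γ.Subgraph).deleteVerts S).coe.ConnectedComponent}
      {x : X} {j : Σ O : Ω, Fin (N O)},
      InComp K (.inr j) → x.1.2 = j.1 → .inl x ∉ S → InComp K (.inl x) :=
    fun hx hxy hy => hx.of_adj hy hxy
  let A : Set Ω := {O | ∀ i : Fin (N O), (Sum.inr ⟨O, i⟩ : X ⊕ _) ∈ S}
  by_cases hall : ∃ K : ((⊤ : Γ.Subgraph).deleteVerts S).coe.ConnectedComponent,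
      ∀ O, ∃ i : Fin (N O), InComp K (.inr ⟨O, i⟩)
  · obtain ⟨K, hK⟩ := hall
    have hall : ∀ w, w ∉ S → InComp K w := by
      rintro (x | ⟨O, i⟩) hw
      · obtain ⟨i, hi⟩ := hK x.1.2
        exact hIX hi rfl hw
      · obtain ⟨j, hj⟩ := hK O
        exact hI hj rfl hw
    have hle : ((⊤ : Γ.Subgraph).deleteVerts S).coe.oddComponents.ncard ≤ 1 := by
      rw [Set.ncard_le_one]
      intro L _ L' _
      obtain ⟨w, hw⟩ := exists_inComp L
      obtain ⟨w', hw'⟩ := exists_inComp L'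
      rw [hw.unique (hall w hw.notMem), hw'.unique (hall w' hw'.notMem)]
    have h1 : ((⊤ : Γ.Subgraph).deleteVerts S).coe.oddComponents.ncard = 1 := by omega
    have hS : S = ∅ := by
      rw [← Set.ncard_eq_zero]; omega
    have hodd : Odd ((⊤ : Γ.Subgraph).deleteVerts S).coe.oddComponents.ncard := by
      rw [h1]; exact odd_one
    rw [odd_ncard_oddComponents] at hodd
    have : Nat.card ((⊤ : Γ.Subgraph).deleteVerts S).verts = Nat.card (X ⊕ Σ O : Ω, Fin (N O)) := by
      rw [hS]
      simp
      rfl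
    rw [this] at hodd
    exact (Nat.not_odd_iff_even.2 hcard) hodd
  push Not at hall
  let r : ((⊤ : Γ.Subgraph).deleteVerts S).coe.ConnectedComponent → X × Fin 3 → Prop :=
    fun K p => (.inl p.1 ∉ S ∧ InComp K (.inl p.1)) ∨
      (.inl p.1 ∈ S ∧ p.2 = 0 ∧ ∃ i : Σ O : Ω, Fin (N O), i.1 = p.1.1.2 ∧ InComp K (.inr i)) ∨
      (.inl p.1 ∈ S ∧ p.2 ≠ 0 ∧ ∃ y : X, y.1.1 = p.1.1.1 ∧ InComp K (.inl y))
  let T : Finset (X × Fin 3) := {p | (.inl p.1 ∉ S ∧ p.2 = 0 ∧ p.1.1.2 ∈ A) ∨ .inl p.1 ∈ S}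
  let C : Finset ((⊤ : Γ.Subgraph).deleteVerts S).coe.ConnectedComponent :=
    ((⊤ : Γ.Subgraph).deleteVerts S).coe.oddComponents.toFinset
  have hr : ∀ p ∈ T, #(bipartiteBelow r C p) ≤ 1 := by
    intro p _
    rw [Finset.card_le_one]
    intro K hK K' hK'
    rw [Finset.mem_bipartiteBelow] at hK hK'
    rcases hK.2 with ⟨h1, h2⟩ | ⟨h1, h2, i, h3, h4⟩ | ⟨h1, h2, i, h3, h4⟩ <;>
    rcases hK'.2 with ⟨h1', h2'⟩ | ⟨h1', h2', i', h3', h4'⟩ | ⟨h1', h2', i', h3', h4'⟩ <;>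
    first
    | exact absurd h1 h1'
    | exact absurd h1' h1
    | exact absurd h2 h2'
    | exact absurd h2' h2
    | skip
    · exact h2.unique h2'
    · exact (hI h4 (h3.trans h3'.symm) h4'.notMem).unique h4'
    · exact (hQ h4 (h3.trans h3'.symm) h4'.notMem).unique h4'
  have hT : #T ≤ 3 * S.ncard := by
    let SX : Finset X := {x | .inl x ∈ S}
    let SI : Finset (Σ O : Ω, Fin (N O)) := {i | i.1 ∈ A}
    let XA : Finset X := {x | x.1.2 ∈ A}
    have hS : #SX + #SI ≤ S.ncard := by
      rw [← Finset.card_disjSum, Set.ncard_eq_toFinset_card']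
      refine Finset.card_le_card ?_
      rintro (x | ⟨O, i⟩) hx
      · simpa [SX] using hx
      · have : O ∈ A := by simpa [SI] using hx
        simpa using this i
    have hXA : #XA ≤ 3 * #SI := by
      let AF : Finset Ω := {O | O ∈ A}
      rw [Finset.card_eq_sum_card_fiberwise (f := fun x : X => x.1.2) (t := AF) (s := XA)
          (by intro x hx; simpa [XA, AF] using hx),
        Finset.card_eq_sum_card_fiberwise (f := fun i : Σ O : Ω, Fin (N O) => i.1) (t := AF)
          (s := SI) (by intro x hx; simpa [SI, AF] using hx), Finset.mul_sum]
      refine Finset.sum_le_sum fun O hO => ?_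
      have hOA : O ∈ A := by simpa [AF] using hO
      have h1 : #{x ∈ XA | x.1.2 = O} ≤ #{v | inc v O} := by
        refine Finset.card_le_card_of_injOn (fun x => x.1.1) ?_ ?_
        · rintro ⟨⟨v, O'⟩, h⟩ hx
          have : O' = O := by simpa using (Finset.mem_filter.1 hx).2
          subst this
          simpa using h
        · rintro ⟨⟨v, O'⟩, h⟩ hx ⟨⟨v', O''⟩, h'⟩ hx' hvv
          have e1 : O' = O := by simpa using (Finset.mem_filter.1 hx).2
          have e2 : O'' = O := by simpa using (Finset.mem_filter.1 hx').2
          have e3 : v = v' := hvv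
          subst e1 e2 e3
          rfl
      have h2 : N O ≤ #{i ∈ SI | i.1 = O} := by
        rw [← Finset.card_fin (N O)]
        refine Finset.card_le_card_of_injOn (fun i => ⟨O, i⟩) ?_ ?_
        · intro i _
          simpa [SI] using hOA
        · intro i _ j _ hij
          simpa using hij
      have := hN O
      have := hN1 O
      omega
    have hTle : T ⊆ XA ×ˢ {0} ∪ SX ×ˢ univ := by
      intro p hp
      simp only [T, mem_filter, mem_univ, true_and] at hp
      simp only [XA, SX, mem_union, mem_product, mem_filter, mem_univ, true_and, mem_singleton,
        and_true]
      tauto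
    have := (Finset.card_le_card hTle).trans (Finset.card_union_le _ _)
    rw [Finset.card_product, Finset.card_product, Finset.card_singleton, Finset.card_univ,
      Fintype.card_fin] at this
    omega
  have hC : ∀ K ∈ C, 3 ≤ #(bipartiteAbove r T K) := by
    intro K hKC
    by_cases hex : ∃ i, InComp K (.inr i)
    · obtain ⟨i₀, hi₀⟩ := hex
      let B : Set Ω := {O | ∃ i : Fin (N O), InComp K (.inr ⟨O, i⟩)}
      refine (hb B ⟨i₀.1, i₀.2, hi₀⟩ ?_).trans ?_
      · obtain ⟨O, hO⟩ := hall K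
        exact ⟨O, fun ⟨i, hi⟩ => hO i hi⟩
      · have htok : ∀ v, ((∃ O ∈ B, inc v O) ∧ ∃ O ∉ B, inc v O) →
            ∃ p ∈ bipartiteAbove r T K, p.1.1.1 = v := by
          rintro v ⟨⟨O, ⟨i, hi⟩, hvO⟩, O', hO', hvO'⟩
          by_cases h1 : (Sum.inl ⟨(v, O), hvO⟩ : X ⊕ _) ∈ S
          · refine ⟨(⟨(v, O), hvO⟩, 0), ?_, rfl⟩
            simp only [mem_bipartiteAbove, T, mem_filter, mem_univ, true_and]
            exact ⟨.inr h1, .inr (.inl ⟨h1, rfl, ⟨O, i⟩, rfl, hi⟩)⟩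
          have hK1 : InComp K (.inl ⟨(v, O), hvO⟩) := hIX hi rfl h1
          by_cases h2 : (Sum.inl ⟨(v, O'), hvO'⟩ : X ⊕ _) ∈ S
          · refine ⟨(⟨(v, O'), hvO'⟩, 1), ?_, rfl⟩
            simp only [mem_bipartiteAbove, T, mem_filter, mem_univ, true_and]
            exact ⟨.inr h2, .inr (.inr ⟨h2, by simp, ⟨(v, O), hvO⟩, rfl, hK1⟩)⟩
          · have hK2 : InComp K (.inl ⟨(v, O'), hvO'⟩) := hQ hK1 rfl h2
            refine ⟨(⟨(v, O'), hvO'⟩, 0), ?_, rfl⟩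
            simp only [mem_bipartiteAbove, T, mem_filter, mem_univ, true_and]
            refine ⟨.inl ⟨h2, fun i => ?_⟩, .inl ⟨h2, hK2⟩⟩
            by_contra hi
            exact hO' ⟨i, hXI hK2 rfl hi⟩
        refine Finset.card_le_card_of_surjOn (fun p : X × Fin 3 => p.1.1.1) ?_
        intro v hv
        obtain ⟨p, hp, rfl⟩ := htok v (by simpa using hv)
        exact ⟨p, hp, rfl⟩
    · push Not at hex
      obtain ⟨w, hw⟩ := exists_inComp K
      obtain ⟨x, rfl⟩ : ∃ x, w = .inl x := by
        rcases w with x | i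
        · exact ⟨x, rfl⟩
        · exact absurd hw (hex i)
      have hxA : x.1.2 ∈ A := by
        intro i
        by_contra hi
        exact hex _ (hXI hw rfl hi)
      have hsupp : ∀ w', InComp K w' → ∃ y : X, w' = .inl y ∧ y.1.1 = x.1.1 := by
        intro w' hw'
        refine hw.induction (P := fun w' => ∃ y : X, w' = .inl y ∧ y.1.1 = x.1.1)
          ⟨x, rfl, rfl⟩ ?_ hw'
        rintro _ (z | i) _ hz hadj ⟨y, rfl, hy⟩
        · exact ⟨z, rfl, hadj.2.symm.trans hy⟩
        · exact absurd hz (hex i)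
      obtain ⟨s, hsS, hsx⟩ : ∃ s : X, .inl s ∈ S ∧ s.1.1 = x.1.1 := by
        by_contra hno
        push Not at hno
        have hodd : Odd K.supp.ncard := by simpa [C] using hKC
        rw [ncard_supp_eq_ncard_inComp] at hodd
        have : {w | InComp K w} = (fun O : {O // inc x.1.1 O} =>
            (Sum.inl ⟨(x.1.1, O.1), O.2⟩ : X ⊕ Σ O : Ω, Fin (N O))) '' Set.univ := by
          ext w'
          constructor
          · intro h
            obtain ⟨⟨⟨v, O⟩, hvO⟩, rfl, rfl⟩ := hsupp w' h
            exact ⟨⟨O, hvO⟩, trivial, rfl⟩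
          · rintro ⟨⟨O, hO⟩, -, rfl⟩
            exact hQ hw rfl fun h => hno _ h rfl
        rw [this, Set.ncard_image_of_injective, Set.ncard_univ, Nat.card_eq_fintype_card,
          Fintype.card_subtype] at hodd
        · exact Nat.not_odd_iff_even.2 (hv _) hodd
        · intro O O' h
          have h := congrArg (fun x : X => x.1.2) (Sum.inl_injective h)
          exact Subtype.ext h
      have hxS := hw.notMem
      have hsx' : s ≠ x := by rintro rfl; exact hxS hsS
      refine (Finset.two_lt_card.2 ⟨(x, 0), ?_, (s, 1), ?_, (s, 2), ?_, ?_, ?_, ?_⟩)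
      · simp only [mem_bipartiteAbove, T, mem_filter, mem_univ, true_and]
        exact ⟨.inl ⟨hxS, hxA⟩, .inl ⟨hxS, hw⟩⟩
      · simp only [mem_bipartiteAbove, T, mem_filter, mem_univ, true_and]
        exact ⟨.inr hsS, .inr (.inr ⟨hsS, by simp, x, hsx.symm, hw⟩)⟩
      · simp only [mem_bipartiteAbove, T, mem_filter, mem_univ, true_and]
        exact ⟨.inr hsS, .inr (.inr ⟨hsS, by simp, x, hsx.symm, hw⟩)⟩
      · simp
      · simp
      · simp
  have hfin := Finset.card_mul_le_card_mul r hC hr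
  have hCc : #C = ((⊤ : Γ.Subgraph).deleteVerts S).coe.oddComponents.ncard :=
    (Set.ncard_eq_toFinset_card' _).symm
  omega

end Gadget

section EvenIncidence

variable {V Ω : Type*} [Fintype V] [Fintype Ω] {inc : V → Ω → Prop}

open Finset in
open scoped Classical in
lemma even_card_gadget {N : Ω → ℕ} (hN : ∀ O, #{v | inc v O} = N O + 2)
    (hv : ∀ v, Even #{O | inc v O}) :
    Even (Nat.card ({p : V × Ω // inc p.1 p.2} ⊕ (Σ O : Ω, Fin (N O)))) := by
  have h1 : Fintype.card {p : V × Ω // inc p.1 p.2} = ∑ v, #{O | inc v O} := by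
    rw [Fintype.card_subtype, Finset.card_filter, Fintype.sum_prod_type]
    simp only [Finset.card_filter]
  have h2 : Fintype.card {p : V × Ω // inc p.1 p.2} = ∑ O, #{v | inc v O} := by
    rw [Fintype.card_subtype, Finset.card_filter, Fintype.sum_prod_type_right]
    simp only [Finset.card_filter]
  have h3 : Even (Fintype.card {p : V × Ω // inc p.1 p.2}) := by
    rw [h1]
    exact Finset.even_sum _ fun v _ => hv v
  rw [Nat.card_sum, Nat.card_eq_fintype_card, Nat.card_eq_fintype_card, Fintype.card_sigma]
  simp only [Fintype.card_fin]
  simp only [hN, Finset.sum_add_distrib, Finset.sum_const, smul_eq_mul] at h2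
  rw [h2] at h3 ⊢
  grind

open Finset in
open scoped Classical in
/-- If every point lies in an even number of blocks, every block has at least three points, and
every proper nonempty family of blocks shares at least three points with the remaining blocks,
then there is a set of incidences that is even at all points and even and nonempty at all
blocks. -/
theorem exists_even_incidence
    (hv : ∀ v, Even #{O | inc v O}) (hO : ∀ O, 3 ≤ #{v | inc v O})
    (hb : ∀ K : Set Ω, K.Nonempty → Kᶜ.Nonempty →
      3 ≤ #{v | (∃ O ∈ K, inc v O) ∧ ∃ O ∉ K, inc v O}) :
    ∃ D : V → Ω → Prop, (∀ v O, D v O → inc v O) ∧ (∀ v, Even #{O | D v O}) ∧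
      (∀ O, Even #{v | D v O}) ∧ ∀ O, ∃ v, D v O := by
  let N : Ω → ℕ := fun O => #{v | inc v O} - 2
  have hN : ∀ O, #{v | inc v O} = N O + 2 := fun O => by have := hO O; simp only [N]; omega
  have hN1 : ∀ O, 1 ≤ N O := fun O => by have := hO O; simp only [N]; omega
  obtain ⟨M, hM⟩ := tutte.2 (gadget_not_isTutteViolator hN hN1 hv hb (even_card_gadget hN hv))
  rw [Subgraph.isPerfectMatching_iff] at hM
  choose π hπ hπu using hM
  have hinv : ∀ w, π (π w) = w := fun w => (hπu _ _ (hπ w).symm).symm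
  have hne : ∀ w, π w ≠ w := fun w => (hπ w).adj_sub.ne'
  have hadj : ∀ w, (gadget inc N).Adj w (π w) := fun w => (hπ w).adj_sub
  obtain ⟨D, hD⟩ : ∃ D : V → Ω → Prop,
      ∀ v O, D v O ↔ ∃ h : inc v O, (π (.inl ⟨(v, O), h⟩)).isLeft :=
    ⟨fun v O => ∃ h : inc v O, (π (.inl ⟨(v, O), h⟩)).isLeft, fun _ _ => Iff.rfl⟩
  have hDO : ∀ O, Even #{v | D v O} ∧ 0 < #{v | D v O} := by
    intro O
    let J : Finset ({p : V × Ω // inc p.1 p.2} ⊕ (Σ O : Ω, Fin (N O))) :=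
      {w | ∃ i, w = .inr i ∧ i.1 = O ∧ (π w).isRight}
    let J' : Finset ({p : V × Ω // inc p.1 p.2} ⊕ (Σ O : Ω, Fin (N O))) :=
      {w | ∃ i, w = .inr i ∧ i.1 = O ∧ (π w).isLeft}
    have hJ : Even #J := by
      refine even_card_of_involution J π ?_ (fun w _ => hne w) fun w _ => hinv w
      intro w hw
      simp only [J, mem_filter, mem_univ, true_and] at hw ⊢
      obtain ⟨i, rfl, hi, hr⟩ := hw
      obtain ⟨j, hj⟩ := Sum.isRight_iff.1 hr
      refine ⟨j, hj, ?_, by simp [hinv]⟩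
      have := hadj (.inr i)
      rw [hj] at this
      exact this.2.symm.trans hi
    have hJJ : #J + #J' = N O := by
      rw [← Finset.card_union_of_disjoint]
      · have : J ∪ J' = univ.image fun i : Fin (N O) => Sum.inr ⟨O, i⟩ := by
          ext w
          simp only [J, J', mem_union, mem_filter, mem_univ, true_and, mem_image]
          constructor
          · rintro (⟨⟨_, i⟩, rfl, rfl, -⟩ | ⟨⟨_, i⟩, rfl, rfl, -⟩) <;> exact ⟨i, rfl⟩
          · rintro ⟨i, rfl⟩
            rcases h : π (.inr ⟨O, i⟩) with y | y
            · exact .inr ⟨_, rfl, rfl, rfl⟩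
            · exact .inl ⟨_, rfl, rfl, rfl⟩
        rw [this, Finset.card_image_of_injective, Finset.card_univ, Fintype.card_fin]
        intro i j h
        simpa using h
      · rw [Finset.disjoint_left]
        intro w h h'
        simp only [J, J', mem_filter, mem_univ, true_and] at h h'
        obtain ⟨-, -, -, h⟩ := h
        obtain ⟨-, -, -, h'⟩ := h'
        cases hw : π w <;> simp [hw] at h h'
    have hX : #{v | inc v O ∧ ¬ D v O} = #J' := by
      refine Finset.card_bij (fun v hv => π (.inl ⟨(v, O), (Finset.mem_filter.1 hv).2.1⟩)) ?_ ?_ ?_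
      · intro v hv
        have h := (Finset.mem_filter.1 hv).2
        have hr : (π (.inl ⟨(v, O), h.1⟩)).isRight := by
          rw [← Sum.not_isLeft]
          simpa [hD, h.1] using h.2
        obtain ⟨i, hi⟩ := Sum.isRight_iff.1 hr
        simp only [J', mem_filter, mem_univ, true_and]
        refine ⟨i, hi, ?_, by simp [hinv]⟩
        have := hadj (.inl ⟨(v, O), h.1⟩)
        rw [hi] at this
        exact Eq.symm this
      · intro v hv v' hv' h
        have := congrArg π h
        rw [hinv, hinv] at this
        simpa using this
      · intro w hw
        simp only [J', mem_filter, mem_univ, true_and] at hw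
        obtain ⟨i, rfl, hi, hl⟩ := hw
        obtain ⟨⟨⟨v, O'⟩, h⟩, hx⟩ := Sum.isLeft_iff.1 hl
        have hadj' := hadj (.inr i)
        rw [hx] at hadj'
        have hO' : O' = O := Eq.trans (show O' = i.1 from hadj') hi
        subst hO'
        have hb : π (.inl ⟨(v, O'), h⟩) = .inr i := by rw [← hx, hinv]
        refine ⟨v, ?_, hb⟩
        simp only [mem_filter, mem_univ, true_and]
        refine ⟨h, fun hvD => ?_⟩
        obtain ⟨_, hl⟩ := (hD _ _).1 hvD
        rw [hb] at hl
        simp at hl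
    have hsplit : #{v | D v O} + #{v | inc v O ∧ ¬ D v O} = #{v | inc v O} := by
      rw [← Finset.card_filter_add_card_filter_not (s := {v | inc v O}) (fun v => D v O),
        Finset.filter_filter, Finset.filter_filter]
      congr 2
      ext v
      simp only [mem_filter, mem_univ, true_and]
      exact ⟨fun h => ⟨((hD _ _).1 h).1, h⟩, fun h => h.2⟩
    have := hN O
    have h2 : #{v | D v O} = #J + 2 := by omega
    rw [h2]
    exact ⟨hJ.add even_two, by omega⟩
  refine ⟨D, fun v O h => ((hD _ _).1 h).1, fun v => ?_, fun O => (hDO O).1, fun O => ?_⟩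
  · let Q : Finset ({p : V × Ω // inc p.1 p.2} ⊕ (Σ O : Ω, Fin (N O))) :=
      {w | ∃ x, w = .inl x ∧ x.1.1 = v ∧ (π w).isLeft}
    have hQ : Even #Q := by
      refine even_card_of_involution Q π ?_ (fun w _ => hne w) fun w _ => hinv w
      intro w hw
      simp only [Q, mem_filter, mem_univ, true_and] at hw ⊢
      obtain ⟨i, rfl, hi, hr⟩ := hw
      obtain ⟨j, hj⟩ := Sum.isLeft_iff.1 hr
      refine ⟨j, hj, ?_, by simp [hinv]⟩
      have := hadj (.inl i)
      rw [hj] at this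
      exact this.2.symm.trans hi
    convert hQ using 1
    refine Finset.card_bij
      (fun O hO => .inl ⟨(v, O), ((hD _ _).1 (Finset.mem_filter.1 hO).2).1⟩) ?_ ?_ ?_
    · intro O hO
      simp only [Q, mem_filter, mem_univ, true_and]
      exact ⟨_, rfl, rfl, ((hD _ _).1 (Finset.mem_filter.1 hO).2).2⟩
    · intro O _ O' _ h
      simpa using h
    · intro w hw
      simp only [Q, mem_filter, mem_univ, true_and] at hw
      obtain ⟨⟨⟨v', O⟩, hi⟩, rfl, rfl, hr⟩ := hw
      refine ⟨O, ?_, rfl⟩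
      simp only [mem_filter, mem_univ, true_and]
      exact (hD _ _).2 ⟨hi, hr⟩
  · obtain ⟨v, hv⟩ := Finset.card_pos.1 (hDO O).2
    exact ⟨v, by simpa using hv⟩

end EvenIncidence

section Balance

open Finset in
open scoped Classical in
/-- A system of equations `f x + f y = h` over `ZMod 2`, one for each edge `xy` of a multigraph,
is solvable if no nonempty set of edges has even degree everywhere. -/
lemma exists_add_eq_of_odd {P Ω : Type*} [Fintype P] [Fintype Ω] (c : P → Bool → Ω)
    (hodd : ∀ Z : Finset P, Z.Nonempty → ∃ O, ¬ Even #{q ∈ Z ×ˢ univ | c q.1 q.2 = O})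
    (h : P → ZMod 2) : ∃ f : Ω → ZMod 2, ∀ p, f (c p false) + f (c p true) = h p := by
  let L : (Ω → ZMod 2) →ₗ[ZMod 2] (P → ZMod 2) :=
    { toFun := fun f p => f (c p false) + f (c p true)
      map_add' := fun f g => by ext p; simp only [Pi.add_apply]; ring
      map_smul' := fun r f => by ext p; simp [mul_add] }
  suffices hL : L.range = ⊤ by
    obtain ⟨f, hf⟩ := LinearMap.range_eq_top.1 hL h
    exact ⟨f, fun p => congrFun hf p⟩
  by_contra hL
  obtain ⟨φ, hφ0, hφ⟩ := Submodule.exists_le_ker_of_lt_top _ (lt_top_iff_ne_top.2 hL)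
  have hφs : ∀ g : P → ZMod 2, φ g = ∑ p, g p * φ (Pi.single p 1) := by
    intro g
    conv_lhs => rw [pi_eq_sum_univ' g]
    simp [map_sum]
  let Z : Finset P := {p | φ (Pi.single p 1) = 1}
  have h01 : ∀ x : ZMod 2, x = if x = 1 then 1 else 0 := by decide
  have hφZ : ∀ g : P → ZMod 2, φ g = ∑ p ∈ Z, g p := by
    intro g
    rw [hφs, Finset.sum_filter]
    refine Finset.sum_congr rfl fun p _ => ?_
    conv_lhs => rw [h01 (φ (Pi.single p 1))]
    split_ifs <;> simp
  have hZ : Z.Nonempty := by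
    rw [Finset.nonempty_iff_ne_empty]
    intro hZ
    apply hφ0
    ext g
    simp [hφZ, hZ]
  obtain ⟨O, hO⟩ := hodd Z hZ
  apply hO
  have h0 : φ (L (Pi.single O 1)) = 0 := hφ ⟨_, rfl⟩
  rw [hφZ] at h0
  rw [← ZMod.natCast_eq_zero_iff_even, ← h0, Finset.card_filter, Finset.sum_product,
    Nat.cast_sum]
  refine Finset.sum_congr rfl fun p _ => ?_
  rw [Fintype.sum_bool]
  simp [L, Pi.single_apply, add_comm]

variable {V Ω : Type*} [Fintype V] [Fintype Ω] {inc : V → Ω → Prop}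

open Finset in
open scoped Classical in
/-- A set of incidences that is even at all points and even and nonempty at all blocks can be
enlarged so that the blocks can be switched to balance the remaining incidences at each point. -/
theorem exists_even_incidence_balanced (hv : ∀ v, Even #{O | inc v O})
    (hD : ∃ D : V → Ω → Prop, (∀ v O, D v O → inc v O) ∧ (∀ v, Even #{O | D v O}) ∧
      (∀ O, Even #{v | D v O}) ∧ ∀ O, ∃ v, D v O) :
    ∃ D : V → Ω → Prop, (∀ v O, D v O → inc v O) ∧
      (∀ O, Even #{v | D v O}) ∧ (∀ O, ∃ v, D v O) ∧
      ∀ h : V → Ω → ZMod 2, ∃ f : Ω → ZMod 2, ∀ v,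
        2 * #{O | inc v O ∧ ¬ D v O ∧ f O + h v O = 1} = #{O | inc v O ∧ ¬ D v O} := by
  obtain ⟨D₀, hD₀⟩ := hD
  obtain ⟨D, -, hD⟩ := Finite.exists_le_maximal (a := D₀)
    (p := fun D : V → Ω → Prop => (∀ v O, D v O → inc v O) ∧ (∀ v, Even #{O | D v O}) ∧
      (∀ O, Even #{v | D v O}) ∧ ∀ O, ∃ v, D v O) hD₀
  obtain ⟨hDinc, hDv, hDO, hDne⟩ := hD.prop
  refine ⟨D, hDinc, hDO, hDne, fun h => ?_⟩
  have hR : ∀ v, Even #{O | inc v O ∧ ¬ D v O} := by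
    intro v
    have : #{O | D v O} + #{O | inc v O ∧ ¬ D v O} = #{O | inc v O} := by
      rw [← Finset.card_filter_add_card_filter_not (s := {O | inc v O}) (fun O => D v O),
        Finset.filter_filter, Finset.filter_filter]
      congr 2
      ext O
      simp only [mem_filter, mem_univ, true_and]
      exact ⟨fun h => ⟨hDinc _ _ h, h⟩, fun h => h.2⟩
    have h1 := hv v
    rw [← this] at h1
    exact (Nat.even_add.1 h1).1 (hDv v)
  choose m hm using hR
  have he : ∀ v, Nonempty ({O // inc v O ∧ ¬ D v O} ≃ Fin (m v) × Bool) := by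
    intro v
    refine ⟨Fintype.equivOfCardEq ?_⟩
    rw [Fintype.card_subtype, hm v, Fintype.card_prod, Fintype.card_fin, Fintype.card_bool]
    ring
  have e := fun v => (he v).some
  let k : (Σ v, Fin (m v)) × Bool → V × Ω := fun q => (q.1.1, ((e q.1.1).symm (q.1.2, q.2)).1)
  have hk : Function.Injective k := by
    rintro ⟨⟨v, i⟩, β⟩ ⟨⟨v', i'⟩, β'⟩ hkk
    obtain rfl : v = v' := congrArg Prod.fst hkk
    have h2 := (e v).symm.injective (Subtype.ext (congrArg Prod.snd hkk))
    simp only [Prod.mk.injEq] at h2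
    obtain ⟨rfl, rfl⟩ := h2
    rfl
  have hkinc : ∀ q, inc (k q).1 (k q).2 ∧ ¬ D (k q).1 (k q).2 := fun q =>
    ((e q.1.1).symm (q.1.2, q.2)).2
  obtain ⟨f, hf⟩ := exists_add_eq_of_odd (fun p β => (k (p, β)).2) (fun Z hZ => by
    by_contra! hall
    obtain ⟨D', hD'⟩ : ∃ D' : V → Ω → Prop,
        ∀ v O, D' v O ↔ D v O ∨ ∃ q ∈ Z ×ˢ univ, k q = (v, O) := ⟨_, fun _ _ => Iff.rfl⟩
    have hle : D ≤ D' := fun v O h => (hD' v O).2 (Or.inl h)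
    have hge : D' ≤ D := by
      refine hD.2 ⟨?_, ?_, ?_, ?_⟩ hle
      · intro v O hvO
        rcases (hD' v O).1 hvO with h | ⟨q, -, hq⟩
        · exact hDinc v O h
        · have := (hkinc q).1
          rwa [hq] at this
      · intro v
        have h1 : #{O | D' v O} = #{O | D v O} + #{q ∈ Z ×ˢ univ | (k q).1 = v} := by
          rw [← Finset.card_image_of_injOn (s := {q ∈ Z ×ˢ univ | (k q).1 = v})
            (f := fun q => (k q).2), ← Finset.card_union_of_disjoint]
          · congr 1
            ext O
            simp only [hD', mem_filter, mem_univ, true_and, mem_union, mem_image, Prod.ext_iff]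
            tauto
          · rw [Finset.disjoint_left]
            intro O hO hO'
            obtain ⟨q, hq, rfl⟩ := Finset.mem_image.1 hO'
            have hqv := (Finset.mem_filter.1 hq).2
            have := (hkinc q).2
            rw [hqv] at this
            exact this (Finset.mem_filter.1 hO).2
          · intro q hq q' hq' hqq
            exact hk (Prod.ext ((Finset.mem_filter.1 hq).2.trans (Finset.mem_filter.1 hq').2.symm)
              hqq)
        have h2 : {q ∈ Z ×ˢ (univ : Finset Bool) | (k q).1 = v} = {p ∈ Z | p.1 = v} ×ˢ univ := by
          ext q
          simp [k]
        rw [h1, h2, Finset.card_product, Finset.card_univ, Fintype.card_bool]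
        exact (hDv v).add (even_two.mul_left _)
      · intro O
        have h1 : #{v | D' v O} = #{v | D v O} + #{q ∈ Z ×ˢ univ | (k q).2 = O} := by
          rw [← Finset.card_image_of_injOn (s := {q ∈ Z ×ˢ univ | (k q).2 = O})
            (f := fun q => (k q).1), ← Finset.card_union_of_disjoint]
          · congr 1
            ext v
            simp only [hD', mem_filter, mem_univ, true_and, mem_union, mem_image, Prod.ext_iff]
            tauto
          · rw [Finset.disjoint_left]
            intro v hv hv'
            obtain ⟨q, hq, rfl⟩ := Finset.mem_image.1 hv'
            have hqO := (Finset.mem_filter.1 hq).2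
            have := (hkinc q).2
            rw [hqO] at this
            exact this (Finset.mem_filter.1 hv).2
          · intro q hq q' hq' hqq
            exact hk (Prod.ext hqq
              ((Finset.mem_filter.1 hq).2.trans (Finset.mem_filter.1 hq').2.symm))
        rw [h1]
        exact (hDO O).add (hall O)
      · intro O
        obtain ⟨v, hv⟩ := hDne O
        exact ⟨v, hle _ _ hv⟩
    obtain ⟨p, hp⟩ := hZ
    exact (hkinc (p, true)).2 (hge _ _ ((hD' _ _).2 (.inr ⟨(p, true), by simp [hp], rfl⟩))))
    (fun p => 1 + h p.1 (k (p, false)).2 + h p.1 (k (p, true)).2)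
  refine ⟨f, fun v => ?_⟩
  rw [hm v, ← two_mul]
  congr 1
  have h01 : ∀ x y : ZMod 2, x + y = 1 →
      (if x = 1 then 1 else 0) + (if y = 1 then 1 else 0) = 1 := by decide
  have h02 : ∀ a b c d : ZMod 2, a + b = 1 + c + d → b + d + (a + c) = 1 := by decide
  let g : Ω → ZMod 2 := fun O => f O + h v O
  have h1 : #{O | inc v O ∧ ¬ D v O ∧ f O + h v O = 1} =
      #{x : Fin (m v) × Bool | g ((e v).symm x).1 = 1} := by
    symm
    refine Finset.card_bij (fun x _ => ((e v).symm x).1) ?_ ?_ ?_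
    · intro x hx
      simp only [mem_filter, mem_univ, true_and] at hx ⊢
      exact ⟨((e v).symm x).2.1, ((e v).symm x).2.2, hx⟩
    · intro x _ y _ hxy
      exact (e v).symm.injective (Subtype.ext hxy)
    · intro O hO
      simp only [mem_filter, mem_univ, true_and] at hO
      refine ⟨e v ⟨O, hO.1, hO.2.1⟩, ?_, by simp⟩
      simpa [g] using hO.2.2
  rw [h1, Finset.card_filter, Fintype.sum_prod_type]
  trans ∑ _i : Fin (m v), 1
  · refine Finset.sum_congr rfl fun i _ => ?_
    rw [Fintype.sum_bool]
    refine h01 _ _ ?_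
    have := hf ⟨v, i⟩
    simp only [g]
    simp only [k] at this
    exact h02 _ _ _ _ this
  · simp

end Balance

section Joins

variable {V : Type*} [Fintype V] {G : SimpleGraph V}

open Finset in
open scoped Classical in
/-- A connected subgraph contains a `T`-join for each even set `T` of its vertices. -/
lemma exists_join (H : G.Subgraph) (hH : H.Connected) (T : V → ZMod 2)
    (hT : ∑ v with v ∈ H.verts, T v = 0) :
    ∃ c : Sym2 V → ZMod 2, ∀ v ∈ H.verts, ∑ w with H.Adj v w, c s(v, w) = T v := by
  let Ach : (V → ZMod 2) → Prop := fun T =>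
    ∃ c : Sym2 V → ZMod 2, ∀ v ∈ H.verts, ∑ w with H.Adj v w, c s(v, w) = T v
  change Ach T
  have hadd : ∀ T T', Ach T → Ach T' → Ach (T + T') := by
    rintro T T' ⟨c, hc⟩ ⟨c', hc'⟩
    exact ⟨c + c', fun v hv => by simp [Finset.sum_add_distrib, hc v hv, hc' v hv]⟩
  have hzero : Ach 0 := ⟨0, fun v _ => by simp⟩
  have hself : ∀ T : V → ZMod 2, T + T = 0 := fun T => funext fun v => CharTwo.add_self_eq_zero _
  have hsmul : ∀ (r : ZMod 2) T, Ach T → Ach (r • T) := by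
    rintro r T ⟨c, hc⟩
    exact ⟨r • c, fun v hv => by simp [← Finset.mul_sum, hc v hv]⟩
  have hadj : ∀ a b, H.Adj a b → Ach (Pi.single a 1 + Pi.single b 1) := by
    intro a b hab
    refine ⟨Pi.single s(a, b) 1, fun v _ => ?_⟩
    have hne : a ≠ b := hab.ne
    simp only [Pi.add_apply, Pi.single_apply]
    by_cases hva : v = a
    · subst hva
      rw [Finset.sum_eq_single b]
      · simp [hne]
      · intro w _ hwb
        rw [if_neg]
        simp only [Sym2.eq_iff]
        rintro (⟨-, h⟩ | ⟨h, -⟩)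
        · exact hwb h
        · exact hne h
      · intro h
        simp [hab] at h
    · by_cases hvb : v = b
      · subst hvb
        rw [Finset.sum_eq_single a]
        · simp [hva]
        · intro w _ hwb
          rw [if_neg]
          simp only [Sym2.eq_iff]
          rintro (⟨h, -⟩ | ⟨-, h⟩)
          · exact hva h
          · exact hwb h
        · intro h
          simp [hab.symm] at h
      · rw [Finset.sum_eq_zero]
        · simp [hva, hvb]
        · intro w _
          rw [if_neg]
          simp only [Sym2.eq_iff]
          rintro (⟨h, -⟩ | ⟨h, -⟩)
          · exact hva h
          · exact hvb h
  obtain ⟨v₀, hv₀⟩ := hH.nonempty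
  have hreach : ∀ a, a ∈ H.verts → Ach (Pi.single v₀ 1 + Pi.single a 1) := by
    intro a ha
    have hr := hH.coe.preconnected ⟨v₀, hv₀⟩ ⟨a, ha⟩
    rw [reachable_iff_reflTransGen] at hr
    suffices h : ∀ y : H.verts, Relation.ReflTransGen H.coe.Adj ⟨v₀, hv₀⟩ y →
        Ach (Pi.single v₀ 1 + Pi.single y.1 1) from h _ hr
    intro y hy
    induction hy with
    | refl => simpa [hself] using hzero
    | @tail y z _ hyz ih =>
      have := hadd _ _ ih (hadj y.1 z.1 hyz)
      rwa [add_assoc, ← add_assoc (Pi.single y.1 1), hself, zero_add] at this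
  have hsum : ∀ s : Finset V, (∀ v ∈ s, v ∈ H.verts) →
      Ach (∑ a ∈ s, T a • (Pi.single v₀ 1 + Pi.single a 1)) := by
    intro s
    induction s using Finset.induction_on with
    | empty => exact fun _ => hzero
    | insert a s has ih =>
      intro hs
      rw [Finset.sum_insert has]
      exact hadd _ _ (hsmul _ _ (hreach a (hs a (by simp))))
        (ih fun v hv => hs v (by simp [hv]))
  obtain ⟨c, hc⟩ := hsum {v | v ∈ H.verts} (by simp)
  refine ⟨c, fun v hv => (hc v hv).trans ?_⟩
  simp only [smul_add, Finset.sum_add_distrib, ← Finset.sum_smul, hT]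
  simp [Finset.sum_apply, Pi.single_apply, Finset.sum_ite_eq, hv]

open Finset in
open scoped Classical in
/-- The edges of a cycle can be 2-coloured so that the colour changes exactly at a given set `T` of
an even number of vertices; `h` records the colour at the remaining vertices. -/
lemma IsCycleSG.exists_coloring {H : G.Subgraph} (hH : IsCycleSG H) (T : V → Prop)
    (hTH : ∀ v, T v → v ∈ H.verts) (hT : Even #{v | T v}) :
    ∃ (c : Sym2 V → ZMod 2) (h : V → ZMod 2), ∀ v ∈ H.verts, ∀ f : ZMod 2,
      #{w | H.Adj v w ∧ f + c s(v, w) = 1} = if T v then 1 else if f + h v = 1 then 2 else 0 := by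
  obtain ⟨c, hc⟩ := exists_join H hH.1 (fun v => if T v then 1 else 0) (by
    refine Eq.trans ?_ (ZMod.natCast_eq_zero_iff_even.2 hT)
    rw [Finset.card_filter, Finset.sum_filter]
    push_cast
    refine Finset.sum_congr rfl fun v _ => ?_
    by_cases h : T v
    · simp [h, hTH v h]
    · simp [h])
  have key : ∀ v : V, ∃ h : ZMod 2, v ∈ H.verts → ∀ f : ZMod 2,
      #{w | H.Adj v w ∧ f + c s(v, w) = 1} = if T v then 1 else if f + h = 1 then 2 else 0 := by
    intro v
    by_cases hv : v ∈ H.verts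
    swap
    · exact ⟨0, fun h => absurd h hv⟩
    have h2 := hH.2 v hv
    rw [sdeg, Set.ncard_eq_two] at h2
    obtain ⟨x, y, hxy, hN⟩ := h2
    have hN' : ∀ w, H.Adj v w ↔ w = x ∨ w = y := fun w => by
      rw [← Subgraph.mem_neighborSet, hN]; simp
    have hcv := hc v hv
    have hS : ({w | H.Adj v w} : Finset V) = {x, y} := by ext w; simp [hN']
    rw [hS, Finset.sum_pair hxy] at hcv
    refine ⟨c s(v, x), fun _ f => ?_⟩
    rw [← Finset.filter_filter, hS, Finset.card_filter, Finset.sum_pair hxy]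
    have h01 : ∀ a b f : ZMod 2, a + b = 1 →
      (if f + a = 1 then 1 else 0) + (if f + b = 1 then 1 else 0) = 1 := by decide
    have h02 : ∀ a b f : ZMod 2, a + b = 0 →
      (if f + a = 1 then 1 else 0) + (if f + b = 1 then 1 else 0) =
        if f + a = 1 then 2 else 0 := by decide
    by_cases hTv : T v
    · rw [if_pos hTv] at hcv ⊢
      exact h01 _ _ _ hcv
    · rw [if_neg hTv] at hcv ⊢
      exact h02 _ _ _ hcv
  choose h hh using key
  exact ⟨c, h, fun v hv => hh v hv⟩

end Joins

section Decomposition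

variable {V : Type*} {G : SimpleGraph V}

lemma not_isAcyclic_of_even_degree [Finite V] (heven : ∀ v, Even (G.neighborSet v).ncard) {a b : V}
    (hab : G.Adj a b) : ¬ G.IsAcyclic := by
  classical
  have := Fintype.ofFinite V
  intro hG
  have htree := hG.isTree_connectedComponent (G.connectedComponentMk a)
  have hb : b ∈ (G.connectedComponentMk a).supp :=
    ConnectedComponent.sound hab.symm.reachable
  have : Nontrivial (G.connectedComponentMk a) :=
    ⟨⟨⟨a, rfl⟩, ⟨b, hb⟩, fun h => hab.ne (congrArg Subtype.val h)⟩⟩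
  obtain ⟨⟨x, hx⟩, hdeg⟩ := htree.exists_vert_degree_one_of_nontrivial
  rw [degree_eq_one_iff_existsUnique_adj] at hdeg
  obtain ⟨⟨y, hy⟩, hxy, hu⟩ := hdeg
  have hN : G.neighborSet x = {y} := by
    ext z
    constructor
    · intro hz
      have hz' : z ∈ (G.connectedComponentMk a).supp :=
        (ConnectedComponent.sound (Adj.reachable (Adj.symm hz))).trans hx
      exact congrArg Subtype.val (hu ⟨z, hz'⟩ hz)
    · rintro rfl
      exact hxy
  have := heven x
  rw [hN, Set.ncard_singleton] at this
  exact absurd this (by decide)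

lemma Walk.IsCycle.isCycleSG_toSubgraph {u : V} {p : G.Walk u u} (hp : p.IsCycle) :
    IsCycleSG p.toSubgraph :=
  ⟨p.toSubgraph_connected, fun v hv =>
    hp.ncard_neighborSet_toSubgraph_eq_two (by simpa using hv)⟩

open Finset in
open scoped Classical in
lemma card_exists_adj {Ω V : Type*} [Fintype V] [Fintype Ω] {G : SimpleGraph V}
    (H : Ω → G.Subgraph)
    (hH : Pairwise fun O O' => Disjoint (H O).edgeSet (H O').edgeSet) (v : V)
    (P : Ω → V → Prop) :
    #{w | ∃ O, (H O).Adj v w ∧ P O w} = ∑ O, #{w | (H O).Adj v w ∧ P O w} := by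
  rw [← Finset.card_biUnion]
  · congr 1
    ext w
    simp
  · intro O _ O' _ hne
    refine Finset.disjoint_left.2 ?_
    intro w hw hw'
    simp only [mem_filter, mem_univ, true_and] at hw hw'
    exact Set.disjoint_left.1 (hH hne) (Subgraph.mem_edgeSet.2 hw.1) (Subgraph.mem_edgeSet.2 hw'.1)

open Finset in
open scoped Classical in
lemma sdeg_eq_card [Fintype V] (H : G.Subgraph) (v : V) : sdeg H v = #{w | H.Adj v w} := by
  rw [sdeg, Set.ncard_eq_toFinset_card']
  congr 1
  ext w
  simp

lemma sdeg_eq_zero {H : G.Subgraph} {v : V} (hv : v ∉ H.verts) : sdeg H v = 0 := by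
  have : H.neighborSet v = ∅ := by
    ext w
    simp only [Subgraph.mem_neighborSet, Set.mem_empty_iff_false, iff_false]
    exact fun h => hv h.fst_mem
  rw [sdeg, this, Set.ncard_empty]

lemma IsCycleSG.even_sdeg {H : G.Subgraph} (hH : IsCycleSG H) (v : V) : Even (sdeg H v) := by
  by_cases hv : v ∈ H.verts
  · rw [hH.2 v hv]
    exact even_two
  · rw [sdeg_eq_zero hv]
    exact Even.zero

lemma even_ncard_adj_not_exists_adj {Ω V : Type*} [Finite V] [Finite Ω] {G : SimpleGraph V}
    (heven : ∀ v, Even (G.neighborSet v).ncard) (H : Ω → G.Subgraph)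
    (hcyc : ∀ O, IsCycleSG (H O))
    (hH : Pairwise fun O O' => Disjoint (H O).edgeSet (H O').edgeSet) (v : V) :
    Even {w | G.Adj v w ∧ ¬ ∃ O, (H O).Adj v w}.ncard := by
  classical
  have := Fintype.ofFinite V
  have := Fintype.ofFinite Ω
  have h := heven v
  have hcard := card_exists_adj H hH v fun _ _ => True
  simp only [and_true, ← sdeg_eq_card] at hcard
  have hsplit : (G.neighborSet v).ncard =
      (Finset.univ.filter fun w => ∃ O, (H O).Adj v w).card +
        {w | G.Adj v w ∧ ¬ ∃ O, (H O).Adj v w}.ncard := by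
    rw [← Set.ncard_coe_finset, ← Set.ncard_union_eq]
    · congr 1
      ext w
      simp only [mem_neighborSet, Finset.coe_filter, Finset.mem_univ, true_and, Set.mem_union,
        Set.mem_ofPred_eq]
      constructor
      · intro hw
        by_cases hO : ∃ O, (H O).Adj v w
        · exact .inl hO
        · exact .inr ⟨hw, hO⟩
      · rintro (⟨O, hO⟩ | hw)
        · exact hO.adj_sub
        · exact hw.1
    · rw [Set.disjoint_left]
      intro w hw hw'
      simp only [Finset.coe_filter, Finset.mem_univ, true_and, Set.mem_ofPred_eq] at hw
      exact hw'.2 hw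
  rw [hsplit, Nat.even_add] at h
  refine h.1 ?_
  rw [show (Finset.univ.filter fun w => ∃ O, (H O).Adj v w).card = ∑ O, sdeg (H O) v by
    convert hcard]
  exact Finset.even_sum _ fun O _ => (hcyc O).even_sdeg v

open Finset in
open scoped Classical in
/-- In a finite graph with even degrees, every family of edge-disjoint cycles extends to a
decomposition into cycles. -/
theorem exists_cycle_decomposition [Finite V] (heven : ∀ v, Even (G.neighborSet v).ncard)
    (𝒪 : Set G.Subgraph) (hcyc : ∀ O ∈ 𝒪, IsCycleSG O) (hdisj : PairwiseEdgeDisjoint 𝒪) :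
    ∃ 𝒪' : Set G.Subgraph, 𝒪 ⊆ 𝒪' ∧ (∀ O ∈ 𝒪', IsCycleSG O) ∧ PairwiseEdgeDisjoint 𝒪' ∧
      ∀ v w, G.Adj v w → ∃ O ∈ 𝒪', O.Adj v w := by
  have := Fintype.ofFinite V
  obtain ⟨𝒞, hle, h𝒞⟩ := Finite.exists_le_maximal (a := 𝒪)
    (p := fun 𝒞 : Set G.Subgraph => (∀ O ∈ 𝒞, IsCycleSG O) ∧ PairwiseEdgeDisjoint 𝒞) ⟨hcyc, hdisj⟩
  obtain ⟨hcyc', hdisj'⟩ := h𝒞.prop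
  refine ⟨𝒞, hle, hcyc', hdisj', ?_⟩
  by_contra! hno
  obtain ⟨a, b, hab, hno⟩ := hno
  let R : SimpleGraph V := G.deleteEdges (⋃ O ∈ 𝒞, O.edgeSet)
  have hR : ∀ v w, R.Adj v w ↔ G.Adj v w ∧ ¬ ∃ O : 𝒞, O.1.Adj v w := by
    intro v w
    simp [R, deleteEdges_adj]
  have hpw : Pairwise fun O O' : 𝒞 => Disjoint O.1.edgeSet O'.1.edgeSet :=
    fun O O' hne => hdisj' O.2 O'.2 (fun h => hne (Subtype.ext h))
  have hReven : ∀ v, Even (R.neighborSet v).ncard := by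
    intro v
    have : R.neighborSet v = {w | G.Adj v w ∧ ¬ ∃ O : 𝒞, O.1.Adj v w} := Set.ext fun w => hR v w
    rw [this]
    exact even_ncard_adj_not_exists_adj heven (fun O : 𝒞 => O.1) (fun O => hcyc' O.1 O.2) hpw v
  have hRab : R.Adj a b := (hR a b).2 ⟨hab, fun ⟨O, hO⟩ => hno O.1 O.2 hO⟩
  have hRcyc := not_isAcyclic_of_even_degree hReven hRab
  simp only [IsAcyclic, not_forall, not_not] at hRcyc
  obtain ⟨u, p, hp⟩ := hRcyc
  have hle : R ≤ G := deleteEdges_le _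
  let C : G.Subgraph := (p.mapLe hle).toSubgraph
  have hC : IsCycleSG C := Walk.IsCycle.isCycleSG_toSubgraph (hp.mapLe hle)
  have hCR : ∀ e ∈ C.edgeSet, e ∈ R.edgeSet := by
    intro e he
    rw [Walk.mem_edges_toSubgraph, Walk.edges_mapLe_eq_edges] at he
    exact p.edges_subset_edgeSet he
  have hCO : ∀ O ∈ 𝒞, Disjoint C.edgeSet O.edgeSet := by
    intro O hO
    rw [Set.disjoint_left]
    intro e he he'
    have := hCR e he
    rw [edgeSet_deleteEdges] at this
    exact this.2 (Set.mem_biUnion hO he')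
  have hins : insert C 𝒞 ≤ 𝒞 := by
    refine h𝒞.2 ⟨?_, ?_⟩ (Set.subset_insert _ _)
    · rintro O (rfl | hO)
      · exact hC
      · exact hcyc' O hO
    · refine hdisj'.insert fun O hO _ => ⟨hCO O hO, (hCO O hO).symm⟩
  have hCmem : C ∈ 𝒞 := hins (Set.mem_insert _ _)
  obtain ⟨v, hv⟩ := hC.1.nonempty
  have h2 := hC.2 v hv
  obtain ⟨w, hw⟩ : (C.neighborSet v).Nonempty := by
    rw [← Set.ncard_pos]
    unfold sdeg at h2
    omega
  exact Set.disjoint_left.1 (hCO C hCmem) (Subgraph.mem_edgeSet.2 hw) (Subgraph.mem_edgeSet.2 hw)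

end Decomposition

section Factor

lemma IsCycleSG.three_le_ncard_verts {V : Type*} [Finite V] {G : SimpleGraph V} {H : G.Subgraph}
    (hH : IsCycleSG H) : 3 ≤ H.verts.ncard := by
  obtain ⟨v, hv⟩ := hH.1.nonempty
  have hsub : insert v (H.neighborSet v) ⊆ H.verts :=
    Set.insert_subset hv fun w hw => Subgraph.Adj.snd_mem hw
  have hle := Set.ncard_le_ncard hsub (Set.toFinite _)
  rwa [Set.ncard_insert_of_notMem (fun h => h.ne rfl) (Set.toFinite _),
    show (H.neighborSet v).ncard = 2 from hH.2 v hv] at hle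

/-- In a decomposition of a `k`-connected graph into subgraphs with at least `k` vertices, any
nontrivial union of parts shares at least `k` vertices with its complement. -/
lemma KConnected.le_ncard_boundary {V Ω : Type*} [Fintype V] {G : SimpleGraph V} {k : ℕ}
    (hG : KConnected k G) (H : Ω → G.Subgraph) (hH : ∀ O, k ≤ (H O).verts.ncard)
    (hcov : ∀ v w, G.Adj v w → ∃ O, (H O).Adj v w) (K : Set Ω) (hK : K.Nonempty)
    (hK' : Kᶜ.Nonempty) :
    k ≤ {v | (∃ O ∈ K, v ∈ (H O).verts) ∧ ∃ O ∉ K, v ∈ (H O).verts}.ncard := by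
  set B := {v | (∃ O ∈ K, v ∈ (H O).verts) ∧ ∃ O ∉ K, v ∈ (H O).verts} with hB
  by_contra! hlt
  have hconn := hG.2 B hlt
  have hout : ∀ O, ∃ v ∈ (H O).verts, v ∉ B := fun O =>
    Set.exists_mem_notMem_of_ncard_lt_ncard (hlt.trans_le (hH O)) (Set.toFinite _)
  obtain ⟨O, hO⟩ := hK
  obtain ⟨O', hO'⟩ := hK'
  obtain ⟨u, hu, huB⟩ := hout O
  obtain ⟨w, hw, hwB⟩ := hout O'
  have hr := hconn.preconnected ⟨u, huB⟩ ⟨w, hwB⟩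
  rw [reachable_iff_reflTransGen] at hr
  suffices h : ∀ y : (Bᶜ : Set V), Relation.ReflTransGen (G.induce Bᶜ).Adj ⟨u, huB⟩ y →
      ∃ P ∈ K, y.1 ∈ (H P).verts by
    exact hwB ⟨h _ hr, O', hO', hw⟩
  intro y hy
  induction hy with
  | refl => exact ⟨O, hO, hu⟩
  | @tail y z _ hyz ih =>
    obtain ⟨P, hP⟩ := hcov y.1 z.1 hyz
    by_cases hPK : P ∈ K
    · exact ⟨P, hPK, hP.snd_mem⟩
    · exact absurd ⟨ih, P, hPK, hP.fst_mem⟩ y.2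

open Finset in
open scoped Classical in
/-- A decomposition of a graph into cycles, in which every nontrivial union of cycles shares at
least three vertices with the union of the others, has a spanning subgraph with half the degrees that
splits every cycle. -/
lemma exists_half_of_cycle_decomposition {V Ω : Type*} [Fintype V] [Fintype Ω]
    {G : SimpleGraph V} {t : ℕ} (hte : Even t) (H : Ω → G.Subgraph) (hcyc : ∀ O, IsCycleSG (H O))
    (hH : Pairwise fun O O' => Disjoint (H O).edgeSet (H O').edgeSet)
    (hinc : ∀ v, #{O | v ∈ (H O).verts} = t)
    (hb : ∀ K : Set Ω, K.Nonempty → Kᶜ.Nonempty →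
      3 ≤ #{v | (∃ O ∈ K, v ∈ (H O).verts) ∧ ∃ O ∉ K, v ∈ (H O).verts}) :
    ∃ F : G.Subgraph, IsTFactor F t ∧ ∀ O, ((H O).edgeSet ∩ F.edgeSet).Nonempty ∧
      ((H O).edgeSet ∩ (G.edgeSet \ F.edgeSet)).Nonempty := by
  have hv : ∀ v, Even #{O | v ∈ (H O).verts} := fun v => by rwa [hinc]
  have hO : ∀ O, 3 ≤ #{v | v ∈ (H O).verts} := fun O => by
    rw [← Set.ncard_coe_finset]
    simpa using (hcyc O).three_le_ncard_verts
  obtain ⟨D, hDinc, hDO, hDne, hD⟩ :=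
    exists_even_incidence_balanced hv (exists_even_incidence hv hO hb)
  choose c h hch using fun O => (hcyc O).exists_coloring (fun v => D v O) (fun v => hDinc v O) (hDO O)
  obtain ⟨f, hf⟩ := hD fun v O => h O v
  let F : G.Subgraph :=
    { verts := Set.univ
      Adj := fun a b => ∃ O, (H O).Adj a b ∧ f O + c O s(a, b) = 1
      adj_sub := fun ⟨_, h, _⟩ => h.adj_sub
      edge_vert := fun _ => Set.mem_univ _
      symm := ⟨fun a b ⟨O, h, h'⟩ => ⟨O, h.symm, by rwa [Sym2.eq_swap]⟩⟩ }
  refine ⟨F, ⟨fun v => Set.mem_univ v, fun v => ?_⟩, fun O => ?_⟩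
  · have hdeg : sdeg F v = ∑ O, #{w | (H O).Adj v w ∧ f O + c O s(v, w) = 1} := by
      rw [sdeg_eq_card]
      convert card_exists_adj H hH v fun O w => f O + c O s(v, w) = 1
    have hterm : ∀ O, #{w | (H O).Adj v w ∧ f O + c O s(v, w) = 1} =
        (if D v O then 1 else 0) +
          2 * (if v ∈ (H O).verts ∧ ¬ D v O ∧ f O + h O v = 1 then 1 else 0) := by
      intro O
      by_cases hvO : v ∈ (H O).verts
      · rw [hch O v hvO (f O)]
        by_cases hDv : D v O <;> simp [hDv, hvO]
      · have hDv : ¬ D v O := fun h => hvO (hDinc v O h)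
        simp only [hDv, hvO, false_and, if_false, mul_zero, add_zero, card_eq_zero]
        exact Finset.filter_eq_empty_iff.2 fun w _ hw => hvO hw.1.fst_mem
    rw [hdeg]
    calc ∑ O, #{w | (H O).Adj v w ∧ f O + c O s(v, w) = 1}
        = #{O | D v O} + 2 * #{O | v ∈ (H O).verts ∧ ¬ D v O ∧ f O + h O v = 1} := by
          rw [Finset.sum_congr rfl fun O _ => hterm O, Finset.sum_add_distrib, ← Finset.mul_sum,
            Finset.card_filter, Finset.card_filter]
      _ = #{O | D v O} + #{O | v ∈ (H O).verts ∧ ¬ D v O} := by rw [hf v]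
      _ = #{O | v ∈ (H O).verts} := by
          rw [← Finset.card_filter_add_card_filter_not (s := {O | v ∈ (H O).verts}) (D v),
            Finset.filter_filter, Finset.filter_filter]
          congr 2
          ext O
          simpa using hDinc v O
      _ = t := hinc v
  · obtain ⟨v, hDv⟩ := hDne O
    have hvO := hDinc v O hDv
    have h1 := hch O v hvO (f O)
    rw [if_pos hDv, Finset.card_eq_one] at h1
    obtain ⟨x, hx⟩ := h1
    have hx' : ∀ w, (H O).Adj v w ∧ f O + c O s(v, w) = 1 ↔ w = x := fun w => by
      simpa using Finset.ext_iff.1 hx w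
    obtain ⟨hvx, hfx⟩ := (hx' x).2 rfl
    refine ⟨⟨s(v, x), hvx, O, hvx, hfx⟩, ?_⟩
    obtain ⟨y, hy, hyx⟩ : ∃ y ∈ (H O).neighborSet v, y ≠ x :=
      Set.exists_ne_of_one_lt_ncard (one_lt_two.trans_eq ((hcyc O).2 v hvO).symm) x
    refine ⟨s(v, y), hy, Subgraph.Adj.adj_sub hy, ?_⟩
    rintro ⟨O', hO', hfO'⟩
    obtain rfl : O' = O := by
      by_contra hne
      exact Set.disjoint_left.1 (hH hne) (Subgraph.mem_edgeSet.2 hO') (Subgraph.mem_edgeSet.2 hy)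
    exact hyx ((hx' y).1 ⟨hO', hfO'⟩)

end Factor

/-- In a 3-connected 2t-regular graph (`t` even, `t ≥ 2`), for any set of pairwise
edge-disjoint cycles of length at least 3 there is a `t`-factor `F` meeting every cycle
of the set both in an edge of `F` and in an edge outside `F`. -/
theorem stmt_12 {V : Type*} [Fintype V] (t : ℕ) (ht : 2 ≤ t) (hte : Even t)
    (G : SimpleGraph V)
    (hconn : KConnected 3 G) (hreg : IsRegular G (2 * t))
    (𝒪 : Set G.Subgraph) (hcyc : ∀ O ∈ 𝒪, IsCycleSG O ∧ 3 ≤ O.edgeSet.ncard)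
    (hdisj : PairwiseEdgeDisjoint 𝒪) :
    ∃ F : G.Subgraph, IsTFactor F t ∧
      ∀ O ∈ 𝒪, (O.edgeSet ∩ F.edgeSet).Nonempty ∧
        (O.edgeSet ∩ (G.edgeSet \ F.edgeSet)).Nonempty := by
  classical
  obtain ⟨𝒞, hle, h𝒞, hdisj', hcov⟩ := exists_cycle_decomposition
    (fun v => by rw [hreg v]; exact even_two_mul t) 𝒪 (fun O hO => (hcyc O hO).1) hdisj
  have := Fintype.ofFinite 𝒞
  have hpw : Pairwise fun O O' : 𝒞 => Disjoint O.1.edgeSet O'.1.edgeSet :=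
    fun O O' hne => hdisj' O.2 O'.2 (fun h => hne (Subtype.ext h))
  have hcov' : ∀ v w, G.Adj v w → ∃ O : 𝒞, O.1.Adj v w := fun v w hvw => by
    obtain ⟨O, hO, h⟩ := hcov v w hvw
    exact ⟨⟨O, hO⟩, h⟩
  have hinc : ∀ v, (Finset.univ.filter fun O : 𝒞 => v ∈ O.1.verts).card = t := by
    intro v
    have h1 := card_exists_adj (fun O : 𝒞 => O.1) hpw v fun _ _ => True
    simp only [and_true, ← sdeg_eq_card] at h1
    have h2 : ∀ O : 𝒞, sdeg O.1 v = 2 * if v ∈ O.1.verts then 1 else 0 := fun O => by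
      split_ifs with hv
      · exact (h𝒞 O.1 O.2).2 v hv
      · exact sdeg_eq_zero hv
    rw [Finset.sum_congr rfl fun O _ => h2 O, ← Finset.mul_sum, ← Finset.card_filter] at h1
    have h3 : (Finset.univ.filter fun w => ∃ O : 𝒞, O.1.Adj v w).card = 2 * t := by
      rw [← hreg v, ← Set.ncard_coe_finset]
      congr 1
      ext w
      simp only [Finset.coe_filter, Finset.mem_univ, true_and, mem_neighborSet,
        Set.mem_ofPred_eq]
      exact ⟨fun ⟨O, hO⟩ => hO.adj_sub, hcov' v w⟩
    exact Nat.eq_of_mul_eq_mul_left two_pos (h1.symm.trans (Eq.trans (by congr!) h3))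
  have hb : ∀ K : Set 𝒞, K.Nonempty → Kᶜ.Nonempty →
      3 ≤ (Finset.univ.filter fun v =>
        (∃ O ∈ K, v ∈ O.1.verts) ∧ ∃ O ∉ K, v ∈ O.1.verts).card := by
    intro K hK hK'
    have := hconn.le_ncard_boundary (fun O : 𝒞 => O.1)
      (fun O => (h𝒞 O.1 O.2).three_le_ncard_verts) hcov' K hK hK'
    rw [← Set.ncard_coe_finset]
    simpa using this
  obtain ⟨F, hF, hFO⟩ := exists_half_of_cycle_decomposition hte (fun O : 𝒞 => O.1)
    (fun O => h𝒞 O.1 O.2) hpw (fun v => by convert hinc v)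
    (fun K hK hK' => by convert hb K hK hK')
  exact ⟨F, hF, fun O hO => hFO ⟨O, hle hO⟩⟩

end PaperFormalization
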